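/- arXiv:1209.3666 — 2 statements merged into one kernel-verified Lean document; each statement's English description precedes it below -/
import Mathlib

section
/- Let b > 0, a = c = −b, let η₀ ∈ ℝ with η₀ > −3 and η₀ ≠ 0, and let ε ∈ {−1, 1}. Set w := ε(3+2η₀)/√(3(3+η₀)) and B := ε√(3/(3+η₀)). Then the functions φ(x) = η₀·sech²(x/(2√b)) and ψ(x) = B·η₀·sech²(x/(2√b)) satisfy, for every x ∈ ℝ: φ(x) + c·φ''(x) − w·(ψ(x) − b·ψ''(x)) + ψ(x)²/2 = 0 and −w·(φ(x) − b·φ''(x)) + ψ(x) + a·ψ''(x) + φ(x)·ψ(x) = 0. -/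
open Real

theorem deriv_deriv_const_mul_sech_sq (A k x : ℝ) :
    deriv (deriv fun y => A * (1 / Real.cosh (y / k)) ^ 2) x =
      A / k ^ 2 * (4 * (1 / Real.cosh (x / k)) ^ 2 - 6 * ((1 / Real.cosh (x / k)) ^ 2) ^ 2) := by
  have hlin (y : ℝ) : HasDerivAt (fun y : ℝ => y / k) (1 / k) y := (hasDerivAt_id y).div_const k
  have hpos (y : ℝ) : Real.cosh (y / k) ≠ 0 := (Real.cosh_pos _).ne'
  have hsech (y : ℝ) : HasDerivAt (fun y => 1 / Real.cosh (y / k))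
      (-(Real.sinh (y / k) * (1 / k)) / Real.cosh (y / k) ^ 2) y := by
    simpa only [one_div] using (hlin y).cosh.fun_inv (hpos y)
  have hfst : (deriv fun y => A * (1 / Real.cosh (y / k)) ^ 2) =
      fun y => -2 * A / k * (Real.sinh (y / k) * (1 / Real.cosh (y / k)) ^ 3) := by
    funext y
    rw [(((hsech y).fun_pow 2).const_mul A).deriv]
    have := hpos y
    norm_num
    field_simp
  rw [hfst, (((hlin x).sinh.fun_mul ((hsech x).fun_pow 3)).const_mul (-2 * A / k)).deriv]
  have := hpos x
  have hsq : Real.sinh (x / k) ^ 2 = Real.cosh (x / k) ^ 2 - 1 := by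
    linarith [Real.cosh_sq (x / k)]
  norm_num
  field_simp
  rw [hsq]
  ring

theorem stmt_1 (a b c : ℝ) (hb : 0 < b) (ha : a = -b) (hc : c = -b)
    (η₀ : ℝ) (hη1 : η₀ > -3) (hη2 : η₀ ≠ 0)
    (ε : ℝ) (hε : ε = -1 ∨ ε = 1)
    (w B : ℝ)
    (hw : w = ε * (3 + 2*η₀) / Real.sqrt (3 * (3 + η₀)))
    (hB : B = ε * Real.sqrt (3 / (3 + η₀)))
    (φ ψ : ℝ → ℝ)
    (hφ : φ = fun x => η₀ * (1 / Real.cosh (x / (2 * Real.sqrt b)))^2)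
    (hψ : ψ = fun x => B * η₀ * (1 / Real.cosh (x / (2 * Real.sqrt b)))^2) :
    ∀ x : ℝ,
      φ x + c * deriv (deriv φ) x - w * (ψ x - b * deriv (deriv ψ) x) + (ψ x)^2 / 2 = 0 ∧
      -w * (φ x - b * deriv (deriv φ) x) + ψ x + a * deriv (deriv ψ) x + φ x * ψ x = 0 := by
  intro x
  have hpos : 0 < 3 + η₀ := by linarith
  have hεsq : ε ^ 2 = 1 := by rcases hε with rfl | rfl <;> norm_num
  have hBsq : B ^ 2 * (3 + η₀) = 3 := by
    rw [hB, mul_pow, hεsq, Real.sq_sqrt (by positivity)]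
    field_simp
  have hwB : w = B * (3 + 2 * η₀) / 3 := by
    have h3 : Real.sqrt 3 ^ 2 = 3 := Real.sq_sqrt (by norm_num)
    have h3pos : 0 < Real.sqrt 3 := by positivity
    have hs : 0 < Real.sqrt (3 + η₀) := Real.sqrt_pos.2 hpos
    rw [hw, hB, Real.sqrt_mul (by norm_num), Real.sqrt_div (by norm_num)]
    field_simp
    rw [h3]
    ring
  have hk : (2 * Real.sqrt b) ^ 2 = 4 * b := by
    rw [mul_pow, Real.sq_sqrt hb.le]
    norm_num
  have hdd (A : ℝ) : b * deriv (deriv fun y => A * (1 / Real.cosh (y / (2 * Real.sqrt b))) ^ 2) x =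
      A * ((1 / Real.cosh (x / (2 * Real.sqrt b))) ^ 2 -
        3 / 2 * ((1 / Real.cosh (x / (2 * Real.sqrt b))) ^ 2) ^ 2) := by
    rw [deriv_deriv_const_mul_sech_sq, hk]
    field_simp
    ring
  have hφdd := hdd η₀
  have hψdd := hdd (B * η₀)
  rw [← hφ] at hφdd
  rw [← hψ] at hψdd
  have hφx := congrFun hφ x
  have hψx := congrFun hψ x
  rw [ha, hc, neg_mul, neg_mul, neg_mul, hφdd, hψdd, hφx, hψx, hwB]
  generalize (1 / Real.cosh (x / (2 * Real.sqrt b))) ^ 2 = S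
  constructor
  · linear_combination (-(1 / 2) * η₀ * S ^ 2) * hBsq
  · ring
end

section
/- Let a < 0 and b ∈ ℝ, and define φ(x) = −(3/2)·sech²(x/(2√(−a))). Then: (i) ∫_ℝ (a·φ''(x) + φ(x))² dx = (324/35)·√(−a); (ii) ∫_ℝ (φ(x) − b·φ''(x))·(a·φ''(x) + φ(x)) dx = (36/5)·√(−a) + (72/35)·b/√(−a); and consequently the ratio of (ii) to (i) equals 7/9 + (2/9)·(b/(−a)). -/
open MeasureTheory

open Filter Topology

theorem Real.one_div_cosh_sq (x : ℝ) : (1 / Real.cosh x) ^ 2 = 1 - Real.tanh x ^ 2 := by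
  have h := Real.cosh_pos x
  rw [Real.tanh_eq_sinh_div_cosh]
  field_simp
  linarith [Real.cosh_sq x]

theorem Real.hasDerivAt_tanh_div (c x : ℝ) :
    HasDerivAt (fun y => Real.tanh (y / c)) ((1 - Real.tanh (x / c) ^ 2) / c) x := by
  have h := (Real.cosh_pos (x / c)).ne'
  have hd : HasDerivAt (fun y : ℝ => y / c) (1 / c) x := (hasDerivAt_id x).div_const c
  rw [funext fun y : ℝ => Real.tanh_eq_sinh_div_cosh (y / c), Real.tanh_eq_sinh_div_cosh]
  refine (hd.sinh.div hd.cosh h).congr_deriv ?_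
  field_simp

theorem Real.tendsto_tanh_atTop : Tendsto Real.tanh atTop (𝓝 1) := by
  have h : ∀ x, Real.tanh x = 1 - 2 / (Real.exp (2 * x) + 1) := by
    intro x
    have h2 : Real.exp (2 * x) = Real.exp x ^ 2 := by
      rw [two_mul, Real.exp_add, sq]
    have := Real.exp_pos x
    rw [Real.tanh_eq, h2, Real.exp_neg]
    field_simp
    ring
  have h2 : Tendsto (fun x : ℝ => Real.exp (2 * x) + 1) atTop atTop :=
    tendsto_atTop_add_const_right _ _
      (Real.tendsto_exp_atTop.comp (tendsto_id.const_mul_atTop two_pos))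
  simpa [funext h] using (h2.const_div_atTop 2).const_sub 1

theorem Real.tendsto_tanh_atBot : Tendsto Real.tanh atBot (𝓝 (-1)) := by
  simpa [Function.comp_def] using (Real.tendsto_tanh_atTop.comp tendsto_neg_atBot_atTop).neg

/-- A continuous nonnegative derivative of a function with limits at `±∞` is integrable. -/
theorem integrable_of_hasDerivAt_of_nonneg {F f : ℝ → ℝ} {m n : ℝ} (hf : Continuous f)
    (hF : ∀ x, HasDerivAt F (f x) x) (h0 : ∀ x, 0 ≤ f x)
    (hbot : Tendsto F atBot (𝓝 m)) (htop : Tendsto F atTop (𝓝 n)) : Integrable f := by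
  refine integrable_of_intervalIntegral_norm_tendsto (n - m)
    (a := fun x : ℝ => -x) (b := fun x => x) (l := atTop)
    (fun x => (hf.integrableOn_Icc).mono_set Set.Ioc_subset_Icc_self)
    tendsto_neg_atTop_atBot tendsto_id ?_
  have h : ∀ x, ∫ y in (-x)..x, ‖f y‖ = F x - F (-x) := fun x => by
    simp only [Real.norm_of_nonneg (h0 _)]
    exact intervalIntegral.integral_eq_sub_of_hasDerivAt (fun y _ => hF y)
      (hf.intervalIntegrable _ _)
  simp only [h]
  exact htop.sub (hbot.comp tendsto_neg_atTop_atBot)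

/-- Integration of an even power of `sech`, written through `tanh`, given an odd antiderivative
`P` in the variable `tanh`. -/
theorem integrable_and_integral_one_sub_tanh_sq_pow {c : ℝ} (hc : 0 < c) (k : ℕ) {P : ℝ → ℝ}
    (hP : ∀ t, HasDerivAt P ((1 - t ^ 2) ^ k) t) :
    Integrable (fun x => (1 - Real.tanh (x / c) ^ 2) ^ (k + 1)) ∧
      ∫ x, (1 - Real.tanh (x / c) ^ 2) ^ (k + 1) = c * (P 1 - P (-1)) := by
  have hT : Continuous fun x => Real.tanh (x / c) :=
    continuous_iff_continuousAt.2 fun x => (Real.hasDerivAt_tanh_div c x).continuousAt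
  have hcont : Continuous fun x => (1 - Real.tanh (x / c) ^ 2) ^ (k + 1) := by fun_prop
  have hd : ∀ x, HasDerivAt (fun y => c * P (Real.tanh (y / c)))
      ((1 - Real.tanh (x / c) ^ 2) ^ (k + 1)) x := fun x => by
    refine (((hP _).comp x (Real.hasDerivAt_tanh_div c x)).const_mul c).congr_deriv ?_
    field_simp
    ring
  have htop : Tendsto (fun y => c * P (Real.tanh (y / c))) atTop (𝓝 (c * P 1)) :=
    ((hP 1).continuousAt.tendsto.comp
      (Real.tendsto_tanh_atTop.comp (tendsto_id.atTop_div_const hc))).const_mul c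
  have hbot : Tendsto (fun y => c * P (Real.tanh (y / c))) atBot (𝓝 (c * P (-1))) :=
    ((hP (-1)).continuousAt.tendsto.comp
      (Real.tendsto_tanh_atBot.comp (tendsto_id.atBot_div_const hc))).const_mul c
  have hint := integrable_of_hasDerivAt_of_nonneg hcont hd
    (fun x => pow_nonneg (sub_nonneg.2 (Real.tanh_sq_lt_one _).le) _) hbot htop
  refine ⟨hint, ?_⟩
  rw [integral_of_hasDerivAt_of_tendsto hd hint hbot htop]
  ring

theorem integrable_and_integral_sech_pow_six {c : ℝ} (hc : 0 < c) :
    Integrable (fun x => (1 - Real.tanh (x / c) ^ 2) ^ 3) ∧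
      ∫ x, (1 - Real.tanh (x / c) ^ 2) ^ 3 = 16 / 15 * c := by
  have hP : ∀ t : ℝ, HasDerivAt (fun t : ℝ => t - 2 / 3 * t ^ 3 + 1 / 5 * t ^ 5)
      ((1 - t ^ 2) ^ 2) t := fun t => by
    refine (((hasDerivAt_id t).sub ((hasDerivAt_pow 3 t).const_mul (2 / 3))).add
      ((hasDerivAt_pow 5 t).const_mul (1 / 5))).congr_deriv ?_
    push_cast
    ring
  obtain ⟨h, h'⟩ := integrable_and_integral_one_sub_tanh_sq_pow hc 2 hP
  exact ⟨h, h'.trans (by ring)⟩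

theorem integrable_and_integral_sech_pow_eight {c : ℝ} (hc : 0 < c) :
    Integrable (fun x => (1 - Real.tanh (x / c) ^ 2) ^ 4) ∧
      ∫ x, (1 - Real.tanh (x / c) ^ 2) ^ 4 = 32 / 35 * c := by
  have hP : ∀ t : ℝ, HasDerivAt (fun t : ℝ => t - t ^ 3 + 3 / 5 * t ^ 5 - 1 / 7 * t ^ 7)
      ((1 - t ^ 2) ^ 3) t := fun t => by
    refine ((((hasDerivAt_id t).sub (hasDerivAt_pow 3 t)).add
      ((hasDerivAt_pow 5 t).const_mul (3 / 5))).sub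
      ((hasDerivAt_pow 7 t).const_mul (1 / 7))).congr_deriv ?_
    push_cast
    ring
  obtain ⟨h, h'⟩ := integrable_and_integral_one_sub_tanh_sq_pow hc 3 hP
  exact ⟨h, h'.trans (by ring)⟩

theorem deriv_deriv_one_sub_tanh_sq (A c x : ℝ) :
    deriv (deriv fun y => A * (1 - Real.tanh (y / c) ^ 2)) x =
      A * (4 * (1 - Real.tanh (x / c) ^ 2) - 6 * (1 - Real.tanh (x / c) ^ 2) ^ 2) / c ^ 2 := by
  have h1 : (deriv fun y => A * (1 - Real.tanh (y / c) ^ 2)) = fun y =>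
      -(2 * A / c) * (Real.tanh (y / c) - Real.tanh (y / c) ^ 3) := by
    funext y
    refine ((((Real.hasDerivAt_tanh_div c y).pow 2).const_sub 1).const_mul A).deriv.trans ?_
    push_cast
    ring
  have hT := Real.hasDerivAt_tanh_div c x
  rw [h1]
  refine ((hT.sub (hT.pow 3)).const_mul (-(2 * A / c))).deriv.trans ?_
  push_cast
  ring

theorem stmt_13 (a b : ℝ) (ha : a < 0) (φ : ℝ → ℝ)
    (hφ : φ = fun x => -(3/2) * (1 / Real.cosh (x / (2 * Real.sqrt (-a))))^2) :
    (∫ x : ℝ, (a * deriv (deriv φ) x + φ x)^2) = (324/35) * Real.sqrt (-a) ∧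
    (∫ x : ℝ, (φ x - b * deriv (deriv φ) x) * (a * deriv (deriv φ) x + φ x))
      = (36/5) * Real.sqrt (-a) + (72/35) * b / Real.sqrt (-a) ∧
    (∫ x : ℝ, (φ x - b * deriv (deriv φ) x) * (a * deriv (deriv φ) x + φ x))
        / (∫ x : ℝ, (a * deriv (deriv φ) x + φ x)^2)
      = 7/9 + (2/9) * (b / (-a)) := by
  have hs : 0 < √(-a) := Real.sqrt_pos.2 (neg_pos.2 ha)
  have hsq : -a = √(-a) ^ 2 := (Real.sq_sqrt (neg_pos.2 ha).le).symm
  generalize √(-a) = s at *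
  obtain rfl : a = -s ^ 2 := by linarith
  simp only [Real.one_div_cosh_sq] at hφ
  have hc : 0 < 2 * s := by positivity
  obtain ⟨i3, h3⟩ := integrable_and_integral_sech_pow_six hc
  obtain ⟨i4, h4⟩ := integrable_and_integral_sech_pow_eight hc
  have e1 : (∫ x : ℝ, (-s ^ 2 * deriv (deriv φ) x + φ x)^2) = (324/35) * s := by
    have : ∀ x, (-s ^ 2 * deriv (deriv φ) x + φ x)^2 =
        81 / 16 * (1 - Real.tanh (x / (2 * s)) ^ 2) ^ 4 := fun x => by
      rw [hφ, deriv_deriv_one_sub_tanh_sq]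
      field_simp
      ring
    simp only [this]
    rw [integral_const_mul, h4]
    ring
  have e2 : (∫ x : ℝ, (φ x - b * deriv (deriv φ) x) * (-s ^ 2 * deriv (deriv φ) x + φ x))
      = (36/5) * s + (72/35) * b / s := by
    have : ∀ x, (φ x - b * deriv (deriv φ) x) * (-s ^ 2 * deriv (deriv φ) x + φ x) =
        (27 / 8 - 27 / 8 * b / s ^ 2) * (1 - Real.tanh (x / (2 * s)) ^ 2) ^ 3 +
        81 / 16 * b / s ^ 2 * (1 - Real.tanh (x / (2 * s)) ^ 2) ^ 4 := fun x => by
      rw [hφ, deriv_deriv_one_sub_tanh_sq]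
      field_simp
      ring
    simp only [this]
    rw [integral_add (i3.const_mul _) (i4.const_mul _), integral_const_mul, integral_const_mul,
      h3, h4]
    field_simp
    ring
  refine ⟨e1, e2, ?_⟩
  rw [e1, e2]
  field_simp
  ring
end
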